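/- arXiv:2510.09512 — 7 statements merged into one kernel-verified Lean document; each statement's English description precedes it below -/
import Mathlib

section
/- Let N = (V, E, ω) be a phylogenetic X-network and fix an integer N₀ together with an edge coloring c : E → {1,…,N₀}. Then for every taxon x ∈ X and every set of colors C ⊆ {1,…,N₀}, at most one set of edges is (x,C)-respecting; that is, if F₁ and F₂ are both (x,C)-respecting sets of edges, then F₁ = F₂. -/
attribute [local instance] Classical.propDecidable

noncomputable section

/-- A phylogenetic network on the vertex type `V`: a finite DAG with positive
integer edge weights, a unique in-degree-0 vertex (the root), in which every
non-root vertex is a leaf (taxon), a tree vertex, or a reticulation. -/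
structure PhyloNetwork (V : Type*) [Fintype V] [DecidableEq V] where
  E : Finset (V × V)
  ω : V × V → ℕ
  ω_pos : ∀ e ∈ E, 0 < ω e
  acyclic : ∀ v : V, ¬ Relation.TransGen (fun a b : V => (a, b) ∈ E) v v
  root : V
  root_indeg : ∀ e ∈ E, e.2 ≠ root
  root_unique : ∀ v : V, (∀ e ∈ E, e.2 ≠ v) → v = root
  classify : ∀ v : V, v = root ∨
      ((E.filter (fun e => e.2 = v)).card = 1 ∧ (E.filter (fun e => e.1 = v)).card = 0) ∨
      ((E.filter (fun e => e.2 = v)).card = 1 ∧ 2 ≤ (E.filter (fun e => e.1 = v)).card) ∨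
      ((E.filter (fun e => e.1 = v)).card = 1 ∧ 2 ≤ (E.filter (fun e => e.2 = v)).card)

/-- Reachability by a directed path that uses only edges from `F`. -/
def ReachVia {V : Type*} (F : Finset (V × V)) (u v : V) : Prop :=
  Relation.ReflTransGen (fun a b : V => (a, b) ∈ F) u v

namespace PhyloNetwork

variable {V : Type*} [Fintype V] [DecidableEq V]

/-- A leaf (taxon): in-degree 1 and out-degree 0. -/
def IsLeaf (N : PhyloNetwork V) (v : V) : Prop :=
  (N.E.filter (fun e => e.2 = v)).card = 1 ∧ (N.E.filter (fun e => e.1 = v)).card = 0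

/-- A tree vertex: in-degree 1 and out-degree at least 2. -/
def IsTreeVertex (N : PhyloNetwork V) (v : V) : Prop :=
  (N.E.filter (fun e => e.2 = v)).card = 1 ∧ 2 ≤ (N.E.filter (fun e => e.1 = v)).card

/-- A reticulation: out-degree 1 and in-degree at least 2. -/
def IsReticulation (N : PhyloNetwork V) (v : V) : Prop :=
  (N.E.filter (fun e => e.1 = v)).card = 1 ∧ 2 ≤ (N.E.filter (fun e => e.2 = v)).card

/-- `off v`: the set of leaves reachable from `v` by a directed path. -/
def off (N : PhyloNetwork V) (v : V) : Set V :=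
  {x | N.IsLeaf x ∧ ReachVia N.E v x}

/-- Total weight of a set of edges. -/
def weight (N : PhyloNetwork V) (F : Finset (V × V)) : ℕ := ∑ e ∈ F, N.ω e

/-- Total weight of all edges of the network. -/
def totalWeight (N : PhyloNetwork V) : ℕ := N.weight N.E

/-- `E(S)`: the edges `uv` with `off v ∩ S ≠ ∅`. -/
def edgesTo (N : PhyloNetwork V) (S : Set V) : Finset (V × V) :=
  N.E.filter (fun e => ∃ x ∈ N.off e.2, x ∈ S)

/-- The (all-paths) phylogenetic diversity of a set `S` of taxa. -/
def PD (N : PhyloNetwork V) (S : Set V) : ℕ := N.weight (N.edgesTo S)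

end PhyloNetwork

namespace PhyloNetwork

variable {V : Type*} [Fintype V] [DecidableEq V]

/-- `F` is an `(x, C)`-respecting set of edges for the coloring `c`. -/
def IsRespecting (N : PhyloNetwork V) (c : V × V → ℕ) (C : Finset ℕ) (x : V)
    (F : Finset (V × V)) : Prop :=
  F ⊆ N.E ∧
  (∀ e ∈ N.E, e.2 = x → e ∈ F) ∧
  (∀ e ∈ F, c e ∉ C) ∧
  (∀ e ∈ F, ReachVia F e.2 x) ∧
  ∃ F' : Finset (V × V), F' ⊆ N.E ∧
    (∀ e ∈ F', c e ∈ C) ∧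
    (∀ e₁ ∈ F ∪ F', ∀ e₂ ∈ F ∪ F', c e₁ = c e₂ → e₁ = e₂) ∧
    ∀ e ∈ F, Xor'
      ((∀ e' ∈ N.E, e'.2 = e.1 → e' ∈ F) ∧ (∀ e' ∈ N.E, e'.1 = e.1 → c e' ∉ C))
      ((∀ e' ∈ F, e'.2 ≠ e.1) ∧ ∃ e' ∈ F', e'.1 = e.1 ∧ c e' ∈ C)

end PhyloNetwork

theorem respecting_subset_aux {V : Type*} [Fintype V] [DecidableEq V]
    (N : PhyloNetwork V) (c : V × V → ℕ) (x : V) (C : Finset ℕ)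
    (F₁ F₂ : Finset (V × V))
    (h₁ : N.IsRespecting c C x F₁) (h₂ : N.IsRespecting c C x F₂) :
    F₁ ⊆ F₂ := by
  obtain ⟨hE1, -, -, hr1, A1, -, -, -, hx1⟩ := h₁
  obtain ⟨-, hi2, -, -, A2, hA2, -, -, hx2⟩ := h₂
  have key : ∀ v, ReachVia F₁ v x → ∀ e ∈ F₁, e.2 = v → e ∈ F₂ := by
    intro v hv
    unfold ReachVia at hv
    induction hv using Relation.ReflTransGen.head_induction_on with
    | refl => exact fun e he h => hi2 e (hE1 he) h
    | @head a b hab _ ih =>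
      intro e he hea
      have hab2 := ih (a, b) hab rfl
      have hno : ∀ e' ∈ N.E, e'.1 = a → c e' ∉ C := by
        rcases hx1 _ hab with ⟨⟨_, h⟩, _⟩ | ⟨⟨h, _⟩, _⟩
        · exact h
        · exact absurd hea (h e he)
      rcases hx2 _ hab2 with ⟨⟨h, _⟩, _⟩ | ⟨⟨_, e', he', h1, h2⟩, _⟩
      · exact h e (hE1 he) hea
      · exact absurd h2 (hno e' (hA2 he') h1)
  exact fun e he => key _ (hr1 e he) e he rfl

/-- At most one set of edges is `(x, C)`-respecting. -/
theorem respecting_unique {V : Type*} [Fintype V] [DecidableEq V]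
    (N : PhyloNetwork V) (N₀ : ℕ) (c : V × V → ℕ)
    (hc : ∀ e ∈ N.E, c e ∈ Finset.Icc 1 N₀)
    (x : V) (hx : N.IsLeaf x)
    (C : Finset ℕ) (hC : C ⊆ Finset.Icc 1 N₀)
    (F₁ F₂ : Finset (V × V))
    (h₁ : N.IsRespecting c C x F₁) (h₂ : N.IsRespecting c C x F₂) :
    F₁ = F₂ := by
  exact Finset.Subset.antisymm (respecting_subset_aux N c x C F₁ F₂ h₁ h₂)
    (respecting_subset_aux N c x C F₂ F₁ h₂ h₁)
end
end

section
/- Let N = (V, E, ω) be a phylogenetic X-network with an edge coloring c : E → {1,…,N₀}, let x ∈ X be a taxon and C ⊆ {1,…,N₀} a set of colors. Let F̂ be the smallest set of edges that contains the edge incoming at x and is closed under the rule: whenever uv ∈ F̂ and no edge outgoing of u has a color in C, then all edges incoming at u belong to F̂. Then every (x,C)-respecting set of edges is equal to F̂. -/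
attribute [local instance] Classical.propDecidable

noncomputable section

namespace PhyloNetwork

variable {V : Type*} [Fintype V] [DecidableEq V]

/-- `G` contains the edge incoming at `x` and is closed under the rule: whenever
`uv ∈ G` and no edge outgoing of `u` has a color in `C`, then all edges incoming
at `u` belong to `G`. -/
def IsClosedFam (N : PhyloNetwork V) (c : V × V → ℕ) (C : Finset ℕ) (x : V)
    (G : Finset (V × V)) : Prop :=
  G ⊆ N.E ∧
  (∀ e ∈ N.E, e.2 = x → e ∈ G) ∧
  (∀ e ∈ G, (∀ e' ∈ N.E, e'.1 = e.1 → c e' ∉ C) →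
    ∀ e' ∈ N.E, e'.2 = e.1 → e' ∈ G)

end PhyloNetwork

/-- Every `(x, C)`-respecting set of edges is equal to the smallest set `F̂` of
edges containing the edge incoming at `x` and closed under the closure rule. -/
theorem respecting_eq_closure {V : Type*} [Fintype V] [DecidableEq V]
    (N : PhyloNetwork V) (N₀ : ℕ) (c : V × V → ℕ)
    (hc : ∀ e ∈ N.E, c e ∈ Finset.Icc 1 N₀)
    (x : V) (hx : N.IsLeaf x)
    (C : Finset ℕ) (hC : C ⊆ Finset.Icc 1 N₀)
    (Fhat : Finset (V × V))
    (hclosed : N.IsClosedFam c C x Fhat)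
    (hmin : ∀ G : Finset (V × V), N.IsClosedFam c C x G → Fhat ⊆ G)
    (F : Finset (V × V)) (hF : N.IsRespecting c C x F) :
    F = Fhat := by
  obtain ⟨hFE, hxF, -, hreach, F', hF'E, -, -, hxor⟩ := hF
  obtain ⟨-, hxH, hcl⟩ := hclosed
  apply Finset.Subset.antisymm
  · have key : ∀ v : V, ReachVia F v x → ∀ e ∈ F, e.2 = v → e ∈ Fhat := by
      intro v hv
      unfold ReachVia at hv
      induction hv using Relation.ReflTransGen.head_induction_on with
      | refl => exact fun e he h => hxH e (hFE he) h
      | head hvw _ ih =>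
        intro e he h
        have h1 := ih _ hvw rfl
        rcases hxor _ hvw with ⟨⟨_, h3⟩, _⟩ | ⟨⟨h2, _⟩, _⟩
        · exact hcl _ h1 h3 e (hFE he) h
        · exact absurd h (h2 e he)
    exact fun e he => key e.2 (hreach e he) e he rfl
  · apply hmin
    refine ⟨hFE, hxF, fun e he hno => ?_⟩
    rcases hxor e he with ⟨⟨h2, _⟩, _⟩ | ⟨⟨_, e', he', h1, h2⟩, _⟩
    · exact h2
    · exact absurd h2 (hno e' (hF'E he') h1)
end
end

section
/- Let N = (V, E, ω) be a phylogenetic X-network with an edge coloring c : E → {1,…,N₀} and fix an enumeration x₁,…,xₙ of X. For every perfect triple (A, χ₁, χ₂), the phylogenetic diversity of the complement satisfies PD_N(X \ A) ≥ ω(E) − Σ_{x∈A} ω(F_{x,χ₂(x)}), where F_{x,χ₂(x)} is the (unique) (x,χ₂(x))-respecting set witnessing that the triple is perfect. -/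
attribute [local instance] Classical.propDecidable

noncomputable section

namespace PhyloNetwork

variable {V : Type*} [Fintype V] [DecidableEq V]

/-- `(A, χ₁, χ₂)` is a perfect triple relative to the enumeration `xs` of the taxa,
with `Fx i` the `(xs i, χ₂ i)`-respecting set witnessing the last condition. -/
def IsPerfect (N : PhyloNetwork V) (c : V × V → ℕ) {n : ℕ} (xs : Fin n → V)
    (A : Finset (Fin n)) (χ₁ χ₂ : Fin n → Finset ℕ)
    (Fx : Fin n → Finset (V × V)) : Prop :=
  (∀ i ∈ A, ∀ j ∈ A, i ≠ j → χ₁ i ∩ χ₁ j = ∅) ∧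
  (∀ i ∈ A, ∀ j ∈ A, i ≠ j → χ₂ i ∩ χ₂ j = ∅) ∧
  (∀ i ∈ A, ∀ j ∈ A, i ≤ j → χ₁ i ∩ χ₂ j = ∅) ∧
  (∀ i ∈ A, N.IsRespecting c (χ₂ i) (xs i) (Fx i) ∧ χ₁ i = (Fx i).image c)

end PhyloNetwork

theorem mem_edgesTo_aux {V : Type*} [Fintype V] [DecidableEq V]
    (N : PhyloNetwork V) (S : Set V) (e : V × V) (he : e ∈ N.E) (x : V)
    (hx : x ∈ N.off e.2) (hS : x ∈ S) : e ∈ N.edgesTo S :=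
  Finset.mem_filter.mpr ⟨he, x, hx, hS⟩

theorem cover_aux {V : Type*} [Fintype V] [DecidableEq V]
    (N : PhyloNetwork V) (c : V × V → ℕ)
    {n : ℕ} (xs : Fin n → V)
    (A : Finset (Fin n)) (χ₁ χ₂ : Fin n → Finset ℕ)
    (Fx : Fin n → Finset (V × V))
    (hperf : N.IsPerfect c xs A χ₁ χ₂ Fx) (v : V) :
    (∀ x ∈ N.off v, ∃ i ∈ A, xs i = x) → ∀ e ∈ N.E, e.2 = v → ∃ i ∈ A, e ∈ Fx i := by
  obtain ⟨-, -, h3, h4⟩ := hperf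
  let r : V → V → Prop := fun b a => Relation.TransGen (fun a b : V => (a, b) ∈ N.E) a b
  haveI : IsTrans V r := ⟨fun a b d h1 h2 => Relation.TransGen.trans h2 h1⟩
  haveI : Std.Irrefl r := ⟨fun a h => N.acyclic a h⟩
  have wf : WellFounded r := Finite.wellFounded_of_trans_of_irrefl r
  induction v using wf.induction with
  | _ v ih =>
  intro hoff e he hev
  by_cases hleaf : N.IsLeaf v
  · obtain ⟨i, hi, hx⟩ := hoff v ⟨hleaf, Relation.ReflTransGen.refl⟩
    exact ⟨i, hi, (h4 i hi).1.2.1 e he (hev.trans hx.symm)⟩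
  have hout : ∀ e' ∈ N.E, e'.1 = v → ∃ i ∈ A, e' ∈ Fx i := by
    rintro ⟨a, b⟩ he' rfl
    refine ih b (Relation.TransGen.single he') ?_ _ he' rfl
    intro x hx
    exact hoff x ⟨hx.1, Relation.ReflTransGen.head he' hx.2⟩
  have hex : ∃ e' ∈ N.E, e'.1 = v := by
    have hpos : 0 < (N.E.filter (fun e => e.1 = v)).card := by
      rcases N.classify v with h | h | h | h
      · exact absurd (hev.trans h) (N.root_indeg e he)
      · exact absurd h hleaf
      · omega
      · omega
    obtain ⟨e', h⟩ := Finset.card_pos.mp hpos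
    exact ⟨e', (Finset.mem_filter.mp h).1, (Finset.mem_filter.mp h).2⟩
  let S : Finset (Fin n) := A.filter (fun i => ∃ e' ∈ N.E, e'.1 = v ∧ e' ∈ Fx i)
  have hS : S.Nonempty := by
    obtain ⟨e', he', hv⟩ := hex
    obtain ⟨i, hi, hF⟩ := hout e' he' hv
    exact ⟨i, Finset.mem_filter.mpr ⟨hi, e', he', hv, hF⟩⟩
  obtain ⟨i, hiS, hmax⟩ := S.exists_max_image id hS
  obtain ⟨hi, e', he', hv, hF⟩ := Finset.mem_filter.mp hiS
  obtain ⟨hR, -⟩ := h4 i hi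
  obtain ⟨-, -, -, -, F', hF'E, -, -, hX⟩ := hR
  rcases hX e' hF with h | h
  · exact ⟨i, hi, h.1.1 e he (hev.trans hv.symm)⟩
  · exfalso
    obtain ⟨⟨-, e2, he2, hs, hc2⟩, -⟩ := h
    obtain ⟨j, hj, hjF⟩ := hout e2 (hF'E he2) (hs.trans hv)
    have hjS : j ∈ S := Finset.mem_filter.mpr ⟨hj, e2, hF'E he2, hs.trans hv, hjF⟩
    have hle : j ≤ i := hmax j hjS
    have hmem : c e2 ∈ χ₁ j ∩ χ₂ i := by
      refine Finset.mem_inter.mpr ⟨?_, hc2⟩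
      rw [(h4 j hj).2]
      exact Finset.mem_image_of_mem c hjF
    rw [h3 j hj i hi hle] at hmem
    simp at hmem

/-- For every perfect triple `(A, χ₁, χ₂)`,
`PD(X \ A) ≥ ω(E) − Σ_{x ∈ A} ω(F_{x, χ₂(x)})`. -/
theorem perfect_triple_bound {V : Type*} [Fintype V] [DecidableEq V]
    (N : PhyloNetwork V) (N₀ : ℕ) (c : V × V → ℕ)
    (hc : ∀ e ∈ N.E, c e ∈ Finset.Icc 1 N₀)
    {n : ℕ} (xs : Fin n → V)
    (hxs_inj : Function.Injective xs)
    (hxs_leaf : ∀ i, N.IsLeaf (xs i))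
    (hxs_surj : ∀ v : V, N.IsLeaf v → ∃ i, xs i = v)
    (A : Finset (Fin n)) (χ₁ χ₂ : Fin n → Finset ℕ)
    (hχ : ∀ i ∈ A, χ₁ i ⊆ Finset.Icc 1 N₀ ∧ χ₂ i ⊆ Finset.Icc 1 N₀)
    (Fx : Fin n → Finset (V × V))
    (hperf : N.IsPerfect c xs A χ₁ χ₂ Fx) :
    (N.totalWeight : ℤ) - ∑ i ∈ A, (N.weight (Fx i) : ℤ) ≤
      (N.PD {v : V | N.IsLeaf v ∧ ∀ i ∈ A, xs i ≠ v} : ℤ) := by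
  have hsub : N.E ⊆ N.edgesTo {v : V | N.IsLeaf v ∧ ∀ i ∈ A, xs i ≠ v} ∪ A.biUnion Fx := by
    intro e he
    by_cases h : e ∈ N.edgesTo {v : V | N.IsLeaf v ∧ ∀ i ∈ A, xs i ≠ v}
    · exact Finset.mem_union_left _ h
    · refine Finset.mem_union_right _ (Finset.mem_biUnion.mpr ?_)
      refine cover_aux N c xs A χ₁ χ₂ Fx hperf e.2 ?_ e he rfl
      intro x hx
      by_contra hcon
      exact h (mem_edgesTo_aux N _ e he x hx ⟨hx.1, fun i hi hxi => hcon ⟨i, hi, hxi⟩⟩)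
  have key : N.totalWeight ≤ N.PD {v : V | N.IsLeaf v ∧ ∀ i ∈ A, xs i ≠ v}
      + ∑ i ∈ A, N.weight (Fx i) := by
    unfold PhyloNetwork.totalWeight PhyloNetwork.PD PhyloNetwork.weight
    refine (Finset.sum_le_sum_of_subset hsub).trans ?_
    have h1 := Finset.sum_union_inter (f := N.ω)
      (s₁ := N.edgesTo {v : V | N.IsLeaf v ∧ ∀ i ∈ A, xs i ≠ v}) (s₂ := A.biUnion Fx)
    have h2 : ∑ e ∈ A.biUnion Fx, N.ω e ≤ ∑ i ∈ A, ∑ e ∈ Fx i, N.ω e := by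
      clear h1 hsub hperf hχ
      induction A using Finset.induction_on with
      | empty => simp
      | insert a s ha ih =>
        rw [Finset.biUnion_insert, Finset.sum_insert ha]
        have h3 := Finset.sum_union_inter (f := N.ω) (s₁ := Fx a) (s₂ := s.biUnion Fx)
        omega
    omega
  have key' : (N.totalWeight : ℤ) ≤ (N.PD {v : V | N.IsLeaf v ∧ ∀ i ∈ A, xs i ≠ v} : ℤ)
      + ∑ i ∈ A, (N.weight (Fx i) : ℤ) := by exact_mod_cast key
  linarith
end
end

section
/- For every phylogenetic X-network N, the inequality H ≤ δ^{h_r} · h_t holds (with the convention 0^0 = 1), where δ is the maximum in-degree of a reticulation of N (δ := 0 if N has no reticulation), h_r (resp. h_t) is the maximum number of reticulations (resp. tree vertices) on a single directed path in N, and H is the maximum, over all taxa x ∈ X, of the number of tree edges uv with x ∈ off(v). Moreover, if δ ≥ 2, then also δ^{h_r} · h_t ≤ δ^{h_r + h_t}, and hence H ≤ δ^h for h := h_r + h_t. -/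
attribute [local instance] Classical.propDecidable

noncomputable section

namespace PhyloNetwork

variable {V : Type*} [Fintype V] [DecidableEq V]

/-- A directed path in `N`, given as the list of its vertices. -/
def IsPath (N : PhyloNetwork V) (l : List V) : Prop :=
  l.Chain' (fun a b => (a, b) ∈ N.E)

/-- `h_t`: the maximum number of tree vertices lying on a single directed path. -/
def htPar (N : PhyloNetwork V) : ℕ :=
  sSup {n : ℕ | ∃ l : List V, N.IsPath l ∧
    n = (l.toFinset.filter (fun v => N.IsTreeVertex v)).card}

/-- `h_r`: the maximum number of reticulations lying on a single directed path. -/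
def hrPar (N : PhyloNetwork V) : ℕ :=
  sSup {n : ℕ | ∃ l : List V, N.IsPath l ∧
    n = (l.toFinset.filter (fun v => N.IsReticulation v)).card}

/-- `H`: the maximum, over taxa `x`, of the number of tree edges `uv` with `x ∈ off v`. -/
def Hpar (N : PhyloNetwork V) : ℕ :=
  sSup {n : ℕ | ∃ x : V, N.IsLeaf x ∧
    n = (N.E.filter (fun e => N.IsTreeVertex e.2 ∧ x ∈ N.off e.2)).card}

/-- `δ`: the maximum in-degree of a reticulation of `N` (`0` if there are none). -/
def deltaPar (N : PhyloNetwork V) : ℕ :=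
  sSup {n : ℕ | ∃ v : V, N.IsReticulation v ∧
    n = (N.E.filter (fun e => e.2 = v)).card}

end PhyloNetwork

namespace PhyloNetwork

variable {V : Type*} [Fintype V] [DecidableEq V]

/-- tree vertices from which `v` is reachable -/
def anc (N : PhyloNetwork V) (v : V) : Finset V :=
  Finset.univ.filter (fun u => N.IsTreeVertex u ∧ ReachVia N.E u v)

lemma le_htPar (N : PhyloNetwork V) (l : List V) (h : N.IsPath l) :
    (l.toFinset.filter (fun v => N.IsTreeVertex v)).card ≤ N.htPar := by
  apply le_csSup
  · refine ⟨Fintype.card V, ?_⟩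
    rintro n ⟨l, -, rfl⟩
    exact Finset.card_le_univ _
  · exact ⟨l, h, rfl⟩

lemma le_hrPar (N : PhyloNetwork V) (l : List V) (h : N.IsPath l) :
    (l.toFinset.filter (fun v => N.IsReticulation v)).card ≤ N.hrPar := by
  apply le_csSup
  · refine ⟨Fintype.card V, ?_⟩
    rintro n ⟨l, -, rfl⟩
    exact Finset.card_le_univ _
  · exact ⟨l, h, rfl⟩

lemma le_deltaPar (N : PhyloNetwork V) (v : V) (h : N.IsReticulation v) :
    (N.E.filter (fun e => e.2 = v)).card ≤ N.deltaPar := by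
  apply le_csSup
  · refine ⟨N.E.card, ?_⟩
    rintro n ⟨l, -, rfl⟩
    exact Finset.card_le_card (Finset.filter_subset _ _)
  · exact ⟨v, h, rfl⟩

lemma not_mem_path (N : PhyloNetwork V) (v : V) (l : List V) (h : N.IsPath (v :: l)) :
    v ∉ l := by
  intro hv
  have h1 : List.IsChain (Relation.TransGen (fun a b : V => (a, b) ∈ N.E)) (v :: l) :=
    List.IsChain.imp (fun a b hab => Relation.TransGen.single hab) h
  rw [List.isChain_iff_pairwise, List.pairwise_cons] at h1
  exact N.acyclic v (h1.1 v hv)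

lemma path_cons (N : PhyloNetwork V) (p v : V) (l : List V) (h : N.IsPath (v :: l))
    (hp : (p, v) ∈ N.E) : N.IsPath (p :: v :: l) :=
  List.IsChain.cons_cons hp h

lemma anc_step (N : PhyloNetwork V) (u v : V) (hu : u ∈ N.anc v) (huv : ¬ (u = v)) :
    ∃ e ∈ N.E.filter (fun e => e.2 = v), u ∈ N.anc e.1 := by
  simp only [anc, Finset.mem_filter, Finset.mem_univ, true_and] at hu ⊢
  rcases Relation.ReflTransGen.cases_tail hu.2 with h | ⟨c, hc, hcv⟩
  · exact absurd h.symm huv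
  · exact ⟨(c, v), ⟨hcv, rfl⟩, hu.1, hc⟩

lemma not_mem_of_ret (N : PhyloNetwork V) (v : V) (h1 : N.IsReticulation v)
    (h2 : N.IsTreeVertex v) : False := by
  have := h1.1; have := h2.2; omega

lemma anc_erase (N : PhyloNetwork V) (v : V) (B : ℕ)
    (hB : ∀ e ∈ N.E.filter (fun e => e.2 = v), (N.anc e.1).card ≤ B) :
    ((N.anc v).erase v).card ≤ (N.E.filter (fun e => e.2 = v)).card * B := by
  have hs : (N.anc v).erase v ⊆ (N.E.filter (fun e => e.2 = v)).biUnion (fun e => N.anc e.1) := by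
    intro u hu
    rw [Finset.mem_erase] at hu
    obtain ⟨e, he, h⟩ := N.anc_step u v hu.2 hu.1
    exact Finset.mem_biUnion.2 ⟨e, he, h⟩
  exact (Finset.card_le_card hs).trans (Finset.card_biUnion_le_card_mul _ _ _ hB)

lemma main_aux (N : PhyloNetwork V) (D : ℕ) (hD : 1 ≤ D) (hD' : N.deltaPar ≤ D) (v : V) :
    ∀ l : List V, N.IsPath (v :: l) → (N.anc v).card ≤
      D ^ (N.hrPar - (l.toFinset.filter (fun v => N.IsReticulation v)).card) *
        (N.htPar - (l.toFinset.filter (fun v => N.IsTreeVertex v)).card) := by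
  have wf : WellFounded (Relation.TransGen (fun a b : V => (a, b) ∈ N.E)) := by
    have : Std.Irrefl (Relation.TransGen (fun a b : V => (a, b) ∈ N.E)) := ⟨N.acyclic⟩
    exact Finite.wellFounded_of_trans_of_irrefl _
  induction v using wf.induction with
  | _ v ih =>
  intro l hl
  have ih' : ∀ e ∈ N.E.filter (fun e => e.2 = v), (N.anc e.1).card ≤
      D ^ (N.hrPar - ((v :: l).toFinset.filter (fun v => N.IsReticulation v)).card) *
        (N.htPar - ((v :: l).toFinset.filter (fun v => N.IsTreeVertex v)).card) := by
    rintro ⟨p, w⟩ he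
    rw [Finset.mem_filter] at he
    obtain ⟨he, rfl⟩ := he
    exact ih p (Relation.TransGen.single he) _ (N.path_cons p w l hl he)
  have hvl : v ∉ l.toFinset := by simpa using N.not_mem_path v l hl
  have hr := N.le_hrPar _ hl
  have ht := N.le_htPar _ hl
  have key := N.anc_erase v _ ih'
  rw [List.toFinset_cons, Finset.filter_insert] at hr ht
  rw [List.toFinset_cons, Finset.filter_insert, Finset.filter_insert] at key
  have hcr : v ∉ (l.toFinset.filter (fun v => N.IsReticulation v)) := fun h => hvl (Finset.mem_filter.1 h).1
  have hct : v ∉ (l.toFinset.filter (fun v => N.IsTreeVertex v)) := fun h => hvl (Finset.mem_filter.1 h).1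
  have hroot : v = N.root → (N.E.filter (fun e => e.2 = v)).card = 0 := by
    rintro rfl
    rw [Finset.card_eq_zero, Finset.filter_eq_empty_iff]
    intro e he; exact N.root_indeg e he
  by_cases hT : N.IsTreeVertex v
  · have hR : ¬ N.IsReticulation v := fun h => N.not_mem_of_ret v h hT
    rw [if_neg hR, if_pos hT, hT.1, Finset.card_insert_of_notMem hct, one_mul] at key
    rw [if_pos hT, Finset.card_insert_of_notMem hct] at ht
    have h1 := Finset.pred_card_le_card_erase (s := N.anc v) (a := v)
    obtain ⟨k, hk⟩ := Nat.exists_eq_add_of_le ht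
    have e1 : N.htPar - (l.toFinset.filter (fun v => N.IsTreeVertex v)).card = k + 1 := by omega
    have e2 : N.htPar - ((l.toFinset.filter (fun v => N.IsTreeVertex v)).card + 1) = k := by omega
    rw [e1, mul_add, mul_one]
    rw [e2] at key
    have := Nat.one_le_pow (N.hrPar - (l.toFinset.filter (fun v => N.IsReticulation v)).card) D hD
    omega
  · have hva : v ∉ N.anc v := by simp [anc, hT]
    rw [Finset.erase_eq_of_notMem hva, if_neg hT] at key
    by_cases hR : N.IsReticulation v
    · rw [if_pos hR, Finset.card_insert_of_notMem hcr] at key hr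
      obtain ⟨k, hk⟩ := Nat.exists_eq_add_of_le hr
      have e1 : N.hrPar - (l.toFinset.filter (fun v => N.IsReticulation v)).card = k + 1 := by omega
      have e2 : N.hrPar - ((l.toFinset.filter (fun v => N.IsReticulation v)).card + 1) = k := by omega
      rw [e1]
      rw [e2] at key
      refine key.trans ?_
      rw [pow_succ', mul_assoc]
      exact Nat.mul_le_mul_right _ ((N.le_deltaPar v hR).trans hD')
    · rw [if_neg hR] at key
      have hle : (N.E.filter (fun e => e.2 = v)).card ≤ 1 := by
        rcases N.classify v with h | h | h | h
        · rw [hroot h]; omega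
        · exact h.1.le
        · exact h.1.le
        · exact absurd h hR
      exact key.trans ((Nat.mul_le_mul_right _ hle).trans (one_mul _).le)

lemma H_le_aux (N : PhyloNetwork V) (D : ℕ) (hD : 1 ≤ D) (hD' : N.deltaPar ≤ D) :
    N.Hpar ≤ D ^ N.hrPar * N.htPar := by
  apply csSup_le'
  rintro n ⟨x, hx, rfl⟩
  have h := N.main_aux D hD hD' x [] (List.isChain_singleton x)
  simp only [List.toFinset_nil, Finset.filter_empty, Finset.card_empty, Nat.sub_zero] at h
  refine le_trans ?_ h
  apply Finset.card_le_card_of_injOn (fun e => e.2)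
  · intro e he
    have he := (Finset.mem_filter.1 (Finset.mem_coe.1 he)).2
    exact Finset.mem_coe.2 (Finset.mem_filter.2 ⟨Finset.mem_univ _, he.1, he.2.2⟩)
  · intro e he f hf hef
    have he := Finset.mem_filter.1 (Finset.mem_coe.1 he)
    have hf := Finset.mem_filter.1 (Finset.mem_coe.1 hf)
    exact Finset.card_le_one.1 he.2.1.1.le e (Finset.mem_filter.2 ⟨he.1, rfl⟩) f
      (Finset.mem_filter.2 ⟨hf.1, hef.symm⟩)

lemma hr_zero (N : PhyloNetwork V) (h : N.deltaPar = 0) : N.hrPar = 0 := by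
  apply Nat.le_zero.1
  apply csSup_le'
  rintro n ⟨l, hl, rfl⟩
  rw [Nat.le_zero, Finset.card_eq_zero, Finset.filter_eq_empty_iff]
  intro v _ hv
  have h1 := N.le_deltaPar v hv
  have h2 := hv.2
  omega

end PhyloNetwork

/-- `H ≤ δ^{h_r} · h_t`; moreover if `δ ≥ 2` then `δ^{h_r} · h_t ≤ δ^{h_r + h_t}`,
and hence `H ≤ δ^h` for `h = h_r + h_t`. -/
theorem H_le_delta_pow {V : Type*} [Fintype V] [DecidableEq V] (N : PhyloNetwork V) :
    N.Hpar ≤ N.deltaPar ^ N.hrPar * N.htPar ∧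
    (2 ≤ N.deltaPar →
      N.deltaPar ^ N.hrPar * N.htPar ≤ N.deltaPar ^ (N.hrPar + N.htPar)) ∧
    (2 ≤ N.deltaPar → N.Hpar ≤ N.deltaPar ^ (N.hrPar + N.htPar)) := by
  have h1 : N.Hpar ≤ N.deltaPar ^ N.hrPar * N.htPar := by
    rcases Nat.eq_zero_or_pos N.deltaPar with h | h
    · have h2 := N.H_le_aux 1 le_rfl (by omega)
      rw [N.hr_zero h] at h2 ⊢
      simpa using h2
    · exact N.H_le_aux _ h le_rfl
  have h2 : 2 ≤ N.deltaPar →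
      N.deltaPar ^ N.hrPar * N.htPar ≤ N.deltaPar ^ (N.hrPar + N.htPar) := by
    intro h
    rw [pow_add]
    exact Nat.mul_le_mul_left _ (Nat.lt_pow_self h).le
  exact ⟨h1, h2, fun h => h1.trans (h2 h)⟩
end
end

section
/- Let N = (V, E, ω) be a phylogenetic X-network, c : E_T → {1,…,M} a coloring of its tree edges, and χ : X → 2^{{1,…,M}}. If (S, χ) is colorful, then for all distinct x, y ∈ S, any (x,χ)-suitable set F_x and any (y,χ)-suitable set F_y are disjoint: F_x ∩ F_y = ∅. -/
attribute [local instance] Classical.propDecidable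

noncomputable section

namespace PhyloNetwork

variable {V : Type*} [Fintype V] [DecidableEq V]

/-- `F` is an `(x, χ)`-suitable set of edges for the tree-edge coloring `c`. -/
def IsSuitable (N : PhyloNetwork V) (c : V × V → ℕ) (χ : V → Finset ℕ) (x : V)
    (F : Finset (V × V)) : Prop :=
  F ⊆ N.E ∧
  (∀ e ∈ F, N.IsTreeVertex e.2 → c e ∈ χ x) ∧
  (∀ e₁ ∈ F, ∀ e₂ ∈ F, N.IsTreeVertex e₁.2 → N.IsTreeVertex e₂.2 →
    c e₁ = c e₂ → e₁ = e₂) ∧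
  (∀ e ∈ F, ReachVia F e.2 x)

/-- `(S, χ)` is colorful: distinct members of `S` get disjoint color sets. -/
def Colorful (χ : V → Finset ℕ) (S : Finset V) : Prop :=
  ∀ x ∈ S, ∀ y ∈ S, x ≠ y → χ x ∩ χ y = ∅

end PhyloNetwork

/-- If `(S, χ)` is colorful then suitable sets for distinct taxa of `S` are disjoint. -/
theorem suitable_disjoint {V : Type*} [Fintype V] [DecidableEq V]
    (N : PhyloNetwork V) (M : ℕ) (c : V × V → ℕ)
    (hc : ∀ e ∈ N.E, N.IsTreeVertex e.2 → c e ∈ Finset.Icc 1 M)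
    (χ : V → Finset ℕ) (hχ : ∀ v : V, N.IsLeaf v → χ v ⊆ Finset.Icc 1 M)
    (S : Finset V) (hS : ∀ x ∈ S, N.IsLeaf x)
    (hcol : PhyloNetwork.Colorful χ S)
    (x y : V) (hx : x ∈ S) (hy : y ∈ S) (hxy : x ≠ y)
    (Fx Fy : Finset (V × V))
    (hFx : N.IsSuitable c χ x Fx) (hFy : N.IsSuitable c χ y Fy) :
    Fx ∩ Fy = ∅ := by
  obtain ⟨hxE, hxc, -, hxr⟩ := hFx
  obtain ⟨hyE, hyc, -, hyr⟩ := hFy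
  have hleaf : ∀ v, N.IsLeaf v → ∀ w, (v, w) ∉ N.E := by
    intro v hv w hw
    have h0 := Finset.card_eq_zero.mp hv.2
    have : (v, w) ∈ N.E.filter (fun e => e.1 = v) := Finset.mem_filter.mpr ⟨hw, rfl⟩
    rw [h0] at this
    simp at this
  have key : ∀ v, Relation.ReflTransGen (fun a b : V => (a, b) ∈ Fx) v x →
      ∀ u, (u, v) ∈ Fx → (u, v) ∈ Fy → False := by
    intro v hv
    have tree : ∀ v u, (u, v) ∈ Fx → (u, v) ∈ Fy → ¬ N.IsTreeVertex v := by
      intro v u h1 h2 ht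
      have h := hcol x hx y hy hxy
      have hm : c (u, v) ∈ χ x ∩ χ y :=
        Finset.mem_inter.mpr ⟨hxc _ h1 ht, hyc _ h2 ht⟩
      rw [h] at hm
      simp at hm
    induction hv using Relation.ReflTransGen.head_induction_on with
    | refl =>
      intro u h1 h2
      have hr : Relation.ReflTransGen (fun a b : V => (a, b) ∈ Fy) x y := hyr _ h2
      rcases Relation.ReflTransGen.cases_head hr with h | ⟨w, hw, -⟩
      · exact hxy h
      · exact hleaf x (hS x hx) w (hyE hw)
    | @head v w hvw _ ih =>
      intro u h1 h2
      have hr : Relation.ReflTransGen (fun a b : V => (a, b) ∈ Fy) v y := hyr _ h2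
      rcases Relation.ReflTransGen.cases_head hr with h | ⟨w', hw', -⟩
      · subst h
        exact hleaf v (hS v hy) w (hxE hvw)
      · rcases N.classify v with h | h | h | h
        · exact N.root_indeg _ (hxE h1) h
        · exact hleaf v h w (hxE hvw)
        · exact tree v u h1 h2 h
        · have he := Finset.card_le_one.mp h.1.le (v, w)
            (Finset.mem_filter.mpr ⟨hxE hvw, rfl⟩) (v, w')
            (Finset.mem_filter.mpr ⟨hyE hw', rfl⟩)
          have : w = w' := congrArg Prod.snd he
          subst this
          exact ih v hvw hw'
  refine Finset.eq_empty_of_forall_notMem ?_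
  rintro ⟨u, v⟩ he
  rw [Finset.mem_inter] at he
  exact key v (hxr _ he.1) u he.1 he.2
end
end

section
/- Let N = (V, E, ω) be a phylogenetic X-network, c : E_T → {1,…,M} a coloring of its tree edges, and χ : X → 2^{{1,…,M}}. Suppose (S, χ) is colorful and for each x ∈ S let F_x be an (x,χ)-suitable set of edges. Then the sets F_x (x ∈ S) are pairwise disjoint and PD_N(S) ≥ Σ_{x∈S} ω(F_x). -/
attribute [local instance] Classical.propDecidable

noncomputable section

/-- For a colorful pair `(S, χ)` with suitable sets `Fx x`, the sets are pairwise
disjoint and `PD(S) ≥ Σ_{x ∈ S} ω(Fx x)`. -/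
theorem suitable_PD_bound {V : Type*} [Fintype V] [DecidableEq V]
    (N : PhyloNetwork V) (M : ℕ) (c : V × V → ℕ)
    (hc : ∀ e ∈ N.E, N.IsTreeVertex e.2 → c e ∈ Finset.Icc 1 M)
    (χ : V → Finset ℕ) (hχ : ∀ v : V, N.IsLeaf v → χ v ⊆ Finset.Icc 1 M)
    (S : Finset V) (hS : ∀ x ∈ S, N.IsLeaf x)
    (hcol : PhyloNetwork.Colorful χ S)
    (Fx : V → Finset (V × V))
    (hsuit : ∀ x ∈ S, N.IsSuitable c χ x (Fx x)) :
    (∀ x ∈ S, ∀ y ∈ S, x ≠ y → Fx x ∩ Fx y = ∅) ∧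
    ∑ x ∈ S, N.weight (Fx x) ≤ N.PD ↑S := by
  have hdisj : ∀ x ∈ S, ∀ y ∈ S, x ≠ y → Fx x ∩ Fx y = ∅ := by
    intro x hx y hy hxy
    obtain ⟨hFE, hFc, -, hFr⟩ := hsuit x hx
    obtain ⟨hGE, hGc, -, hGr⟩ := hsuit y hy
    have hout : ∀ z, N.IsLeaf z → ∀ w, (z, w) ∉ N.E := by
      intro z hz w hw
      have h0 := Finset.card_eq_zero.mp hz.2
      have : (z, w) ∈ N.E.filter (fun e => e.1 = z) := Finset.mem_filter.mpr ⟨hw, rfl⟩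
      rw [h0] at this
      exact absurd this (Finset.notMem_empty _)
    have key : ∀ v, ReachVia (Fx x) v x → ∀ u, (u, v) ∈ Fx x → (u, v) ∈ Fx y → False := by
      intro v hv
      have hleaf : ∀ u, N.IsLeaf x → (u, x) ∈ Fx x → (u, x) ∈ Fx y → False := by
        intro u hl _ h2
        rcases Relation.ReflTransGen.cases_head (hGr _ h2) with h | ⟨w, hw, _⟩
        · exact hxy h
        · exact hout _ hl w (hGE hw)
      refine Relation.ReflTransGen.head_induction_on hv ?_ ?_
      · intro u h1 h2
        exact hleaf u (hS x hx) h1 h2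
      · intro a b hab _ ih u h1 h2
        rcases N.classify a with h | h | h | h
        · exact N.root_indeg _ (hFE h1) h
        · exact hout a h b (hFE hab)
        · have e1 := hFc _ h1 h
          have e2 := hGc _ h2 h
          have e3 : c (u, a) ∈ χ x ∩ χ y := Finset.mem_inter.mpr ⟨e1, e2⟩
          rw [hcol x hx y hy hxy] at e3
          exact absurd e3 (Finset.notMem_empty _)
        · rcases Relation.ReflTransGen.cases_head (hGr _ h2) with h' | ⟨w, hw, _⟩
          · exact hout a (by have := hS y hy; rw [← h'] at this; exact this) b (hFE hab)
          · have hbw : (a, b) = (a, w) :=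
              Finset.card_le_one.mp h.1.le _ (Finset.mem_filter.mpr ⟨hFE hab, rfl⟩)
                _ (Finset.mem_filter.mpr ⟨hGE hw, rfl⟩)
            exact ih a hab (by rw [hbw]; exact hw)
    ext e
    constructor
    · intro he
      have h := Finset.mem_inter.mp he
      exact (key e.2 (hFr e h.1) e.1 h.1 h.2).elim
    · intro he
      exact absurd he (Finset.notMem_empty _)
  refine ⟨hdisj, ?_⟩
  unfold PhyloNetwork.PD PhyloNetwork.weight
  rw [← Finset.sum_biUnion]
  · apply Finset.sum_le_sum_of_subset
    intro e he
    obtain ⟨x, hx, hex⟩ := Finset.mem_biUnion.mp he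
    obtain ⟨hFE, -, -, hFr⟩ := hsuit x hx
    have hmem : ∀ T : Set V, (e ∈ N.E ∧ ∃ x ∈ N.off e.2, x ∈ T) → e ∈ N.edgesTo T := by
      intro T hT
      exact Finset.mem_filter.mpr hT
    refine hmem _ ⟨hFE hex, x, ⟨hS x hx, ?_⟩, hx⟩
    exact Relation.ReflTransGen.mono (fun a b h => hFE h) _ _ (hFr e hex)
  · intro x hx y hy hxy
    have := hdisj x hx y hy hxy
    exact Finset.disjoint_iff_inter_eq_empty.mpr (by convert this)
end
end

section
/- Let N = (V, E, ω) be a phylogenetic X-network, let S = {x₁,…,x_k} ⊆ X be a set of k distinct taxa, and let c : E_T → {1,…,M} be a coloring of the tree edges that is injective on E(S) ∩ E_T. For i ∈ {1,…,k} define F_i := {uv ∈ E(S) : x_i ∈ off(v) and x_j ∉ off(v) for all j < i}, and define χ(x_i) := {c(e) : e ∈ F_i ∩ E_T}. Then (S, χ) is colorful, each F_i is (x_i,χ)-suitable, the sets F₁,…,F_k are pairwise disjoint with union E(S), and consequently Σ_{i=1}^{k} ω(F_i) = PD_N(S). -/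
attribute [local instance] Classical.propDecidable

noncomputable section

/-- Splitting `E(S)` among the taxa `x₁, …, x_k` of `S` yields a colorful pair and
pairwise disjoint suitable sets whose union is `E(S)` and whose total weight is
exactly `PD(S)`. -/
theorem suitable_construction {V : Type*} [Fintype V] [DecidableEq V]
    (N : PhyloNetwork V) (M k : ℕ) (c : V × V → ℕ)
    (hc : ∀ e ∈ N.E, N.IsTreeVertex e.2 → c e ∈ Finset.Icc 1 M)
    (xs : Fin k → V) (hxs_inj : Function.Injective xs)
    (hxs_leaf : ∀ i, N.IsLeaf (xs i))
    (S : Finset V) (hSdef : S = Finset.image xs Finset.univ)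
    (hcinj : ∀ e₁ ∈ N.edgesTo ↑S, ∀ e₂ ∈ N.edgesTo ↑S,
      N.IsTreeVertex e₁.2 → N.IsTreeVertex e₂.2 → c e₁ = c e₂ → e₁ = e₂)
    (F : Fin k → Finset (V × V))
    (hFdef : ∀ i, F i = (N.edgesTo ↑S).filter
      (fun e => xs i ∈ N.off e.2 ∧ ∀ j, j < i → xs j ∉ N.off e.2))
    (χ : V → Finset ℕ)
    (hχdef : ∀ i, χ (xs i) = ((F i).filter (fun e => N.IsTreeVertex e.2)).image c) :
    PhyloNetwork.Colorful χ S ∧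
    (∀ i, N.IsSuitable c χ (xs i) (F i)) ∧
    (∀ i j, i ≠ j → F i ∩ F j = ∅) ∧
    Finset.univ.biUnion F = N.edgesTo ↑S ∧
    (∑ i, N.weight (F i)) = N.PD ↑S := by
  have hmem : ∀ i e, e ∈ F i ↔ (e ∈ N.edgesTo (↑S : Set V) ∧
      (xs i ∈ N.off e.2 ∧ ∀ j, j < i → xs j ∉ N.off e.2)) := by
    intro i e
    rw [hFdef i, Finset.mem_filter]
  have hE : ∀ e, e ∈ N.edgesTo (↑S : Set V) ↔ (e ∈ N.E ∧ ∃ i, xs i ∈ N.off e.2) := by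
    intro e
    have h0 : ∀ T : Set V, e ∈ N.edgesTo T ↔ (e ∈ N.E ∧ ∃ x ∈ N.off e.2, x ∈ T) := by
      intro T
      unfold PhyloNetwork.edgesTo
      rw [Finset.mem_filter]
    rw [h0]
    subst hSdef
    constructor
    · rintro ⟨h, x, hx, hxS⟩
      obtain ⟨i, -, rfl⟩ := Finset.mem_image.1 (Finset.mem_coe.1 hxS)
      exact ⟨h, i, hx⟩
    · rintro ⟨h, i, hi⟩
      exact ⟨h, xs i, hi, Finset.mem_coe.2 (Finset.mem_image_of_mem _ (Finset.mem_univ _))⟩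
  have huniq : ∀ i j e, e ∈ F i → e ∈ F j → i = j := by
    intro i j e hi hj
    rw [hmem] at hi hj
    rcases lt_trichotomy i j with h | h | h
    · exact absurd hi.2.1 (hj.2.2 i h)
    · exact h
    · exact absurd hj.2.1 (hi.2.2 j h)
  have hdisj : ∀ i j, i ≠ j → F i ∩ F j = ∅ := by
    intro i j hij
    apply Finset.eq_empty_of_forall_notMem
    intro e he
    rw [Finset.mem_inter] at he
    exact hij (huniq i j e he.1 he.2)
  have hunion : Finset.univ.biUnion F = N.edgesTo (↑S : Set V) := by
    ext e
    rw [Finset.mem_biUnion]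
    constructor
    · rintro ⟨i, -, hi⟩
      exact ((hmem i e).1 hi).1
    · intro he
      obtain ⟨i, hi⟩ := ((hE e).1 he).2
      induction i using WellFoundedLT.induction with
      | ind i ih =>
        by_cases h : ∃ j, j < i ∧ xs j ∈ N.off e.2
        · obtain ⟨j, hj, hj'⟩ := h
          exact ih j hj hj'
        · exact ⟨i, Finset.mem_univ _, (hmem i e).2
            ⟨he, hi, fun j hj hj' => h ⟨j, hj, hj'⟩⟩⟩
  refine ⟨?_, ?_, hdisj, hunion, ?_⟩
  · intro x hx y hy hxy
    rw [hSdef] at hx hy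
    obtain ⟨i, -, rfl⟩ := Finset.mem_image.1 hx
    obtain ⟨j, -, rfl⟩ := Finset.mem_image.1 hy
    apply Finset.eq_empty_of_forall_notMem
    intro a ha
    rw [Finset.mem_inter, hχdef, hχdef, Finset.mem_image, Finset.mem_image] at ha
    obtain ⟨⟨e, he, hea⟩, e', he', hea'⟩ := ha
    rw [Finset.mem_filter] at he he'
    have : e = e' := hcinj e ((hmem i e).1 he.1).1 e' ((hmem j e').1 he'.1).1 he.2 he'.2
      (hea.trans hea'.symm)
    subst this
    exact hxy (congrArg xs (huniq i j e he.1 he'.1))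
  · intro i
    refine ⟨?_, ?_, ?_, ?_⟩
    · intro e he
      exact ((hE e).1 ((hmem i e).1 he).1).1
    · intro e he ht
      rw [hχdef]
      exact Finset.mem_image_of_mem _ (Finset.mem_filter.2 ⟨he, ht⟩)
    · intro e he e' he' ht ht' h
      exact hcinj e ((hmem i e).1 he).1 e' ((hmem i e').1 he').1 ht ht' h
    · intro e he
      obtain ⟨-, h1, h2⟩ := (hmem i e).1 he
      have key : ∀ v, ReachVia N.E v (xs i) → (∀ j, j < i → xs j ∉ N.off v) →
          ReachVia (F i) v (xs i) := by
        intro v hv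
        unfold ReachVia at hv
        induction hv using Relation.ReflTransGen.head_induction_on with
        | refl => intro _; exact Relation.ReflTransGen.refl
        | head hab hb ih =>
          intro hno
          rename_i a b
          have hno' : ∀ j, j < i → xs j ∉ N.off b := fun j hj hjb =>
            hno j hj ⟨hjb.1, Relation.ReflTransGen.head hab hjb.2⟩
          have hoff : xs i ∈ N.off b := ⟨hxs_leaf i, hb⟩
          exact Relation.ReflTransGen.head
            ((hmem i (a, b)).2 ⟨(hE (a, b)).2 ⟨hab, i, hoff⟩, hoff, hno'⟩) (ih hno')
      exact key e.2 h1.2 h2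
  · unfold PhyloNetwork.PD PhyloNetwork.weight
    rw [← hunion, Finset.sum_biUnion]
    intro i _ j _ hij
    exact Finset.disjoint_iff_inter_eq_empty.2 (hdisj i j hij)
end
end
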